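/- Derivative of the truncated-Gaussian mean map lies in (0,1) (supporting fact for the probit contraction). Let ϕ be the standard normal density ϕ(t) = exp(−t²/2)/√(2π) and Φ the standard normal cumulative distribution function, and define h : ℝ → ℝ by h(t) := t + ϕ(t)/Φ(t). Then h is differentiable and for every t ∈ ℝ, 0 < h'(t) < 1. -/

import Mathlib

/-- The standard normal density `ϕ`. -/
noncomputable def stdNormalPdf (t : ℝ) : ℝ := Real.exp (-t ^ 2 / 2) / Real.sqrt (2 * Real.pi)

/-- The standard normal cumulative distribution function `Φ`. -/
noncomputable def stdNormalCdf (t : ℝ) : ℝ := ∫ s in Set.Iic t, stdNormalPdf s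

/-- The mean of a standard Gaussian with mean `t` truncated to the positive half-line:
`h(t) = t + ϕ(t)/Φ(t)`. -/
noncomputable def truncGaussMean (t : ℝ) : ℝ := t + stdNormalPdf t / stdNormalCdf t

open Filter Topology MeasureTheory

lemma stdNormalPdf_pos (t : ℝ) : 0 < stdNormalPdf t := by
  unfold stdNormalPdf
  positivity

lemma hasDerivAt_stdNormalPdf (t : ℝ) : HasDerivAt stdNormalPdf (-t * stdNormalPdf t) t := by
  have h : HasDerivAt (fun x : ℝ => -x ^ 2 / 2) (-t) t := by
    refine (((hasDerivAt_id t).pow 2).neg.div_const 2).congr_deriv ?_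
    simp only [Nat.cast_ofNat, Nat.add_one_sub_one, pow_one, id_eq]
    ring
  refine (h.exp.div_const (Real.sqrt (2 * Real.pi))).congr_deriv ?_
  unfold stdNormalPdf
  ring

lemma continuous_stdNormalPdf : Continuous stdNormalPdf :=
  continuous_iff_continuousAt.2 fun t => (hasDerivAt_stdNormalPdf t).continuousAt

lemma integrable_stdNormalPdf : Integrable stdNormalPdf := by
  refine ((integrable_exp_neg_mul_sq (b := 1 / 2) (by norm_num)).div_const
    (Real.sqrt (2 * Real.pi))).congr (ae_of_all _ fun t => ?_)
  simp only [stdNormalPdf]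
  ring_nf

lemma hasDerivAt_stdNormalCdf (t : ℝ) : HasDerivAt stdNormalCdf (stdNormalPdf t) t := by
  have h : stdNormalCdf = fun x => stdNormalCdf 0 + ∫ s in (0 : ℝ)..x, stdNormalPdf s := by
    funext x
    rw [← intervalIntegral.integral_Iic_sub_Iic integrable_stdNormalPdf.integrableOn
      integrable_stdNormalPdf.integrableOn]
    simp [stdNormalCdf]
  rw [h]
  exact (intervalIntegral.integral_hasDerivAt_right
    (continuous_stdNormalPdf.intervalIntegrable _ _)
    (continuous_stdNormalPdf.stronglyMeasurableAtFilter _ _)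
    continuous_stdNormalPdf.continuousAt).const_add _

lemma tendsto_stdNormalCdf_atBot : Tendsto stdNormalCdf atBot (𝓝 0) :=
  tendsto_integral_Iic_zero tendsto_id

/-- A function with positive derivative that vanishes at `-∞` is positive. -/
lemma pos_of_hasDerivAt_pos_of_tendsto_atBot {f f' : ℝ → ℝ} (hf : ∀ x, HasDerivAt f (f' x) x)
    (hf' : ∀ x, 0 < f' x) (h0 : Tendsto f atBot (𝓝 0)) (t : ℝ) : 0 < f t := by
  have hmono : StrictMono f :=
    strictMono_of_deriv_pos fun x => by rw [(hf x).deriv]; exact hf' x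
  exact (hmono.monotone.le_of_tendsto h0 (t - 1)).trans_lt (hmono (sub_one_lt t))

lemma stdNormalCdf_pos (t : ℝ) : 0 < stdNormalCdf t :=
  pos_of_hasDerivAt_pos_of_tendsto_atBot hasDerivAt_stdNormalCdf stdNormalPdf_pos
    tendsto_stdNormalCdf_atBot t

lemma tendsto_pow_mul_stdNormalPdf_atBot (k : ℕ) :
    Tendsto (fun t => t ^ k * stdNormalPdf t) atBot (𝓝 0) := by
  have h := ((tendsto_rpow_abs_mul_exp_neg_mul_sq_cocompact (a := 1 / 2) (by norm_num) k).mono_left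
    atBot_le_cocompact).div_const (Real.sqrt (2 * Real.pi))
  rw [zero_div] at h
  refine squeeze_zero_norm (fun t => le_of_eq ?_) h
  rw [norm_mul, norm_pow, Real.norm_eq_abs, Real.norm_of_nonneg (stdNormalPdf_pos t).le,
    Real.rpow_natCast, stdNormalPdf]
  ring_nf

lemma tendsto_stdNormalPdf_atBot : Tendsto stdNormalPdf atBot (𝓝 0) := by
  simpa using tendsto_pow_mul_stdNormalPdf_atBot 0

lemma stdNormalCdf_le_stdNormalPdf {t : ℝ} (ht : t ≤ -1) : stdNormalCdf t ≤ stdNormalPdf t := by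
  have hd (x : ℝ) : HasDerivAt (fun y => stdNormalPdf y - stdNormalCdf y)
      (-x * stdNormalPdf x - stdNormalPdf x) x :=
    (hasDerivAt_stdNormalPdf x).sub (hasDerivAt_stdNormalCdf x)
  have hmono : MonotoneOn (fun y => stdNormalPdf y - stdNormalCdf y) (Set.Iic (-1)) := by
    refine monotoneOn_of_deriv_nonneg (convex_Iic _)
      (fun x _ => (hd x).continuousAt.continuousWithinAt)
      (fun x _ => (hd x).differentiableAt.differentiableWithinAt) fun x hx => ?_
    rw [(hd x).deriv]
    have hx' : x ∈ Set.Iic (-1) := interior_subset hx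
    rw [Set.mem_Iic] at hx'
    nlinarith [stdNormalPdf_pos x]
  have h0 : Tendsto (fun y => stdNormalPdf y - stdNormalCdf y) atBot (𝓝 0) := by
    simpa using tendsto_stdNormalPdf_atBot.sub tendsto_stdNormalCdf_atBot
  refine sub_nonneg.1 (le_of_tendsto h0 ?_)
  filter_upwards [eventually_le_atBot t] with s hs
  exact hmono (hs.trans ht) ht hs

lemma tendsto_pow_mul_stdNormalCdf_atBot (k : ℕ) :
    Tendsto (fun t => t ^ k * stdNormalCdf t) atBot (𝓝 0) := by
  refine squeeze_zero_norm' ?_ (tendsto_zero_iff_norm_tendsto_zero.1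
    (tendsto_pow_mul_stdNormalPdf_atBot k))
  filter_upwards [eventually_le_atBot (-1)] with t ht
  rw [norm_mul, norm_mul, Real.norm_of_nonneg (stdNormalCdf_pos t).le,
    Real.norm_of_nonneg (stdNormalPdf_pos t).le]
  gcongr
  exact stdNormalCdf_le_stdNormalPdf ht

lemma mul_stdNormalCdf_add_stdNormalPdf_pos (t : ℝ) :
    0 < t * stdNormalCdf t + stdNormalPdf t := by
  refine pos_of_hasDerivAt_pos_of_tendsto_atBot (f := fun t => t * stdNormalCdf t + stdNormalPdf t)
    (fun x => ?_) stdNormalCdf_pos ?_ t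
  · refine (((hasDerivAt_id x).mul (hasDerivAt_stdNormalCdf x)).add
      (hasDerivAt_stdNormalPdf x)).congr_deriv ?_
    simp
  · simpa using (tendsto_pow_mul_stdNormalCdf_atBot 1).add tendsto_stdNormalPdf_atBot

lemma one_add_sq_mul_stdNormalCdf_add_mul_stdNormalPdf_pos (t : ℝ) :
    0 < (1 + t ^ 2) * stdNormalCdf t + t * stdNormalPdf t := by
  refine pos_of_hasDerivAt_pos_of_tendsto_atBot
    (f := fun t => (1 + t ^ 2) * stdNormalCdf t + t * stdNormalPdf t)
    (f' := fun t => 2 * (t * stdNormalCdf t + stdNormalPdf t)) (fun x => ?_)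
    (fun x => mul_pos two_pos (mul_stdNormalCdf_add_stdNormalPdf_pos x)) ?_ t
  · refine (((((hasDerivAt_id x).pow 2).const_add 1).mul (hasDerivAt_stdNormalCdf x)).add
      ((hasDerivAt_id x).mul (hasDerivAt_stdNormalPdf x))).congr_deriv ?_
    simp
    ring
  · simpa [add_mul] using (tendsto_stdNormalCdf_atBot.add
      (tendsto_pow_mul_stdNormalCdf_atBot 2)).add (tendsto_pow_mul_stdNormalPdf_atBot 1)

lemma stdNormalPdf_mul_lt_stdNormalCdf_sq (t : ℝ) :
    stdNormalPdf t * (t * stdNormalCdf t + stdNormalPdf t) < stdNormalCdf t ^ 2 := by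
  refine sub_pos.1 (pos_of_hasDerivAt_pos_of_tendsto_atBot
    (f := fun t => stdNormalCdf t ^ 2 - stdNormalPdf t * (t * stdNormalCdf t + stdNormalPdf t))
    (f' := fun t => stdNormalPdf t * ((1 + t ^ 2) * stdNormalCdf t + t * stdNormalPdf t))
    (fun x => ?_) (fun x => mul_pos (stdNormalPdf_pos x)
      (one_add_sq_mul_stdNormalCdf_add_mul_stdNormalPdf_pos x)) ?_ t)
  · refine (((hasDerivAt_stdNormalCdf x).pow 2).sub ((hasDerivAt_stdNormalPdf x).mul
      (((hasDerivAt_id x).mul (hasDerivAt_stdNormalCdf x)).add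
        (hasDerivAt_stdNormalPdf x)))).congr_deriv ?_
    simp
    ring
  · simpa using (tendsto_stdNormalCdf_atBot.pow 2).sub (tendsto_stdNormalPdf_atBot.mul
      ((tendsto_pow_mul_stdNormalCdf_atBot 1).add tendsto_stdNormalPdf_atBot))

lemma hasDerivAt_truncGaussMean (t : ℝ) :
    HasDerivAt truncGaussMean
      (1 - stdNormalPdf t * (t * stdNormalCdf t + stdNormalPdf t) / stdNormalCdf t ^ 2) t := by
  refine ((hasDerivAt_id t).add ((hasDerivAt_stdNormalPdf t).div (hasDerivAt_stdNormalCdf t)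
    (stdNormalCdf_pos t).ne')).congr_deriv ?_
  ring

/-- The truncated-Gaussian mean map is differentiable with derivative strictly between
`0` and `1` (supporting fact for the probit contraction). -/
theorem truncGaussMean_deriv_mem_Ioo :
    Differentiable ℝ truncGaussMean ∧
    ∀ t : ℝ, 0 < deriv truncGaussMean t ∧ deriv truncGaussMean t < 1 := by
  refine ⟨fun t => (hasDerivAt_truncGaussMean t).differentiableAt, fun t => ?_⟩
  have hc := stdNormalCdf_pos t
  rw [(hasDerivAt_truncGaussMean t).deriv]
  refine ⟨sub_pos.2 ((div_lt_one (by positivity)).2 (stdNormalPdf_mul_lt_stdNormalCdf_sq t)),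
    sub_lt_self _ (div_pos (mul_pos (stdNormalPdf_pos t)
      (mul_stdNormalCdf_add_stdNormalPdf_pos t)) (by positivity))⟩
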